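/- Set r = σ2²/σ1², W1 = (X1 − X2)/(1+r), W2 = (r X1 + X2)/(1+r), μ1 = (θ1 − θ2)/(1+r), μ2 = (r θ1 + θ2)/(1+r). Then: (a) W1 and W2 are independent, with W1 ~ N_p(μ1, (σ1²/(1+r)) I_p) and W2 ~ N_p(μ2, (σ2²/(1+r)) I_p); (b) for every measurable ψ : ℝ^p → ℝ^p with E‖ψ(W1) − μ1‖² < ∞, the estimator δ_ψ(X) = W2 + ψ(W1) of θ1 has squared-error risk E_θ‖δ_ψ(X) − θ1‖² = E‖ψ(W1) − μ1‖² + p σ2²/(1+r); (c) consequently, for ψ_A, ψ_B measurable, δ_{ψ_A} has squared-error risk no larger than δ_{ψ_B} at θ if and only if E‖ψ_A(W1) − μ1‖² ≤ E‖ψ_B(W1) − μ1‖², where W1 ~ N_p(μ1, (σ1²/(1+r)) I_p). -/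

import Mathlib

open MeasureTheory Real Set

noncomputable section

abbrev Ep (p : ℕ) := EuclideanSpace ℝ (Fin p)

/-- Density of `N_p(0, v I_p)` evaluated at `u`. -/
def gdens (p : ℕ) (v : ℝ) (u : Ep p) : ℝ :=
  (2 * Real.pi * v) ^ (-(p : ℝ) / 2) * Real.exp (-‖u‖ ^ 2 / (2 * v))

/-- Joint density of `X = (X1, X2)`. -/
def jointDens (p : ℕ) (σ12 σ22 : ℝ) (θ1 θ2 : Ep p) (x : Ep p × Ep p) : ℝ :=
  gdens p σ12 (x.1 - θ1) * gdens p σ22 (x.2 - θ2)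

lemma measurable_gdens (p : ℕ) (v : ℝ) : Measurable (gdens p v) := by
  unfold gdens
  fun_prop

lemma gdens_nonneg (p : ℕ) {v : ℝ} (hv : 0 < v) (u : Ep p) : 0 ≤ gdens p v u := by
  unfold gdens
  positivity

/-- Integration against a measure with nonnegative real density. -/
lemma integral_withDensity_ofReal {α E : Type*} [MeasurableSpace α] {μ : Measure α}
    [NormedAddCommGroup E] [NormedSpace ℝ E]
    {f : α → ℝ} (hf : Measurable f) (hf0 : ∀ x, 0 ≤ f x) (g : α → E) :
    ∫ x, g x ∂(μ.withDensity fun x => ENNReal.ofReal (f x)) = ∫ x, f x • g x ∂μ := by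
  rw [integral_withDensity_eq_integral_toReal_smul hf.ennreal_ofReal (by simp)]
  simp [ENNReal.toReal_ofReal, hf0]

/-- The Gaussian measure `N_p(m, v I_p)`, given by its density. -/
abbrev gaussianDens (p : ℕ) (v : ℝ) (m : Ep p) : Measure (Ep p) :=
  (volume : Measure (Ep p)).withDensity fun w => ENNReal.ofReal (gdens p v (w - m))

lemma measurable_gdens_sub (p : ℕ) (v : ℝ) (m : Ep p) :
    Measurable fun w : Ep p => gdens p v (w - m) :=
  (measurable_gdens p v).comp (measurable_id.sub_const m)

lemma integrable_exp_neg_mul_sq_norm (p : ℕ) {b : ℝ} (hb : 0 < b) :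
    Integrable fun w : Ep p => Real.exp (-b * ‖w‖ ^ 2) := by
  refine Integrable.of_integral_ne_zero ?_
  rw [GaussianFourier.integral_rexp_neg_mul_sq_norm hb]
  positivity

lemma gdens_eq (p : ℕ) (v : ℝ) (u : Ep p) :
    gdens p v u =
      (2 * Real.pi * v) ^ (-(p : ℝ) / 2) * Real.exp (-(1 / (2 * v)) * ‖u‖ ^ 2) := by
  unfold gdens
  congr 2
  ring

lemma integral_gdens (p : ℕ) {v : ℝ} (hv : 0 < v) : ∫ u : Ep p, gdens p v u = 1 := by
  simp_rw [gdens_eq]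
  rw [integral_const_mul, GaussianFourier.integral_rexp_neg_mul_sq_norm (by positivity),
    finrank_euclideanSpace_fin, show Real.pi / (1 / (2 * v)) = 2 * Real.pi * v by field_simp,
    ← Real.rpow_add (by positivity), neg_div, neg_add_cancel, Real.rpow_zero]

lemma isProbabilityMeasure_gaussianDens (p : ℕ) {v : ℝ} (hv : 0 < v) (m : Ep p) :
    IsProbabilityMeasure (gaussianDens p v m) := by
  constructor
  have hint : Integrable fun u : Ep p => gdens p v u := by
    simp_rw [gdens_eq]
    exact (integrable_exp_neg_mul_sq_norm p (by positivity)).const_mul _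
  rw [withDensity_apply _ MeasurableSet.univ, Measure.restrict_univ,
    ← ofReal_integral_eq_lintegral_ofReal (hint.comp_sub_right m)
      (.of_forall fun w => gdens_nonneg p hv _),
    integral_sub_right_eq_self (gdens p v) m, integral_gdens p hv, ENNReal.ofReal_one]

lemma charFun_gaussianDens (p : ℕ) {v : ℝ} (hv : 0 < v) (m t : Ep p) :
    charFun (gaussianDens p v m) t =
      Complex.exp (inner ℝ t m * Complex.I - v * ‖t‖ ^ 2 / 2) := by
  rw [charFun_apply, integral_withDensity_ofReal (measurable_gdens_sub p v m)
    fun w => gdens_nonneg p hv _]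
  let F : Ep p → ℂ := fun u => (((2 * Real.pi * v) ^ (-(p : ℝ) / 2) : ℝ) : ℂ) *
    Complex.exp (inner ℝ t m * Complex.I) *
    Complex.exp (-((1 / (2 * v) : ℝ) : ℂ) * ‖u‖ ^ 2 + Complex.I * inner ℝ t u)
  have key : ∀ w : Ep p,
      gdens p v (w - m) • Complex.exp (inner ℝ w t * Complex.I) = F (w - m) := by
    intro w
    simp only [F, gdens_eq, Complex.real_smul]
    push_cast
    simp only [mul_assoc, ← Complex.exp_add]
    rw [real_inner_comm t w, inner_sub_right]
    congr 2
    push_cast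
    ring
  rw [integral_congr_ae (.of_forall key), integral_sub_right_eq_self F m,
    integral_const_mul,
    GaussianFourier.integral_cexp_neg_mul_sq_norm_add (by simpa using hv), finrank_euclideanSpace_fin]
  have h1 : ((Real.pi : ℂ) / ((1 / (2 * v) : ℝ) : ℂ)) ^ ((p : ℂ) / 2) =
      (((2 * Real.pi * v) ^ ((p : ℝ) / 2) : ℝ) : ℂ) := by
    rw [Complex.ofReal_cpow (by positivity)]
    congr 1
    · rw [← Complex.ofReal_div]
      congr 1
      field_simp
    · push_cast; rfl
  have h2 : (((2 * Real.pi * v) ^ (-(p : ℝ) / 2) : ℝ) : ℂ) *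
      (((2 * Real.pi * v) ^ ((p : ℝ) / 2) : ℝ) : ℂ) = 1 := by
    rw [← Complex.ofReal_mul, ← Real.rpow_add (by positivity), neg_div, neg_add_cancel,
      Real.rpow_zero, Complex.ofReal_one]
  have hv' : (v : ℂ) ≠ 0 := by exact_mod_cast hv.ne'
  rw [h1, mul_mul_mul_comm, h2, one_mul, ← Complex.exp_add, Complex.I_sq]
  congr 1
  push_cast
  field_simp
  ring

lemma gaussianDens_eq_multivariateGaussian (p : ℕ) {v : ℝ} (hv : 0 < v) (m : Ep p) :
    gaussianDens p v m = ProbabilityTheory.multivariateGaussian m (v • 1) := by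
  have := isProbabilityMeasure_gaussianDens p hv m
  refine Measure.ext_of_charFun (funext fun t => ?_)
  rw [charFun_gaussianDens p hv,
    ProbabilityTheory.charFun_multivariateGaussian (Matrix.PosSemidef.one.smul hv.le)]
  have : dotProduct t.ofLp (Matrix.mulVec (v • (1 : Matrix (Fin p) (Fin p) ℝ)) t.ofLp) = v * ‖t‖ ^ 2 := by
    rw [Matrix.smul_mulVec, Matrix.one_mulVec, dotProduct_smul, EuclideanSpace.real_norm_sq_eq]
    simp [dotProduct, sq]
  rw [this]
  push_cast
  rfl

lemma isGaussian_gaussianDens (p : ℕ) {v : ℝ} (hv : 0 < v) (m : Ep p) :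
    ProbabilityTheory.IsGaussian (gaussianDens p v m) := by
  rw [gaussianDens_eq_multivariateGaussian p hv]
  infer_instance

lemma integral_id_gaussianDens (p : ℕ) {v : ℝ} (hv : 0 < v) (m : Ep p) :
    ∫ w, w ∂(gaussianDens p v m) = m := by
  rw [gaussianDens_eq_multivariateGaussian p hv,
    ProbabilityTheory.integral_id_multivariateGaussian]

lemma memLp_sub_gaussianDens (p : ℕ) {v : ℝ} (hv : 0 < v) (m : Ep p) :
    MemLp (fun w => w - m) 2 (gaussianDens p v m) := by
  have := isGaussian_gaussianDens p hv m
  exact ProbabilityTheory.IsGaussian.memLp_two_id.sub (memLp_const m)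

lemma integral_norm_sub_sq_gaussianDens (p : ℕ) {v : ℝ} (hv : 0 < v) (m : Ep p) :
    ∫ w, ‖w - m‖ ^ 2 ∂(gaussianDens p v m) = p * v := by
  have hG := isGaussian_gaussianDens p hv m
  have hL := memLp_sub_gaussianDens p hv m
  simp_rw [EuclideanSpace.real_norm_sq_eq]
  rw [integral_finsetSum]
  · have hi : ∀ i : Fin p, ∫ w : Ep p, (w - m) i ^ 2 ∂(gaussianDens p v m) = v := by
      intro i
      have h := ProbabilityTheory.variance_eval_multivariateGaussian (μ := m)
        ((Matrix.PosSemidef.one (n := Fin p) (R := ℝ)).smul hv.le) i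
      have hm : ∫ w : Ep p, w i ∂(gaussianDens p v m) = m i := by
        have := (EuclideanSpace.proj i : Ep p →L[ℝ] ℝ).integral_comp_comm
          (ProbabilityTheory.IsGaussian.integrable_fun_id (μ := gaussianDens p v m))
        rw [integral_id_gaussianDens p hv m] at this
        exact this
      rw [← gaussianDens_eq_multivariateGaussian p hv,
        ProbabilityTheory.variance_eq_integral (by fun_prop), hm] at h
      simpa using h
    rw [Finset.sum_congr rfl fun i _ => hi i]
    simp
  · intro i _
    refine MemLp.integrable_sq (hL.of_le (by fun_prop) (.of_forall fun w => ?_))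
    exact PiLp.norm_apply_le _ i

/-- A linear change of variables between probability densities which agree up to a constant
factor. -/
lemma map_withDensity_of_eq_const_mul {E : Type*} [NormedAddCommGroup E] [NormedSpace ℝ E]
    [FiniteDimensional ℝ E] [MeasurableSpace E] [BorelSpace E] (μ : Measure E)
    [μ.IsAddHaarMeasure] (L : E ≃ₗ[ℝ] E) {f g : E → ℝ} {K : ℝ} (hK : 0 ≤ K)
    (hg : Measurable g) (h : ∀ x, f x = K * g (L x))
    [IsProbabilityMeasure (μ.withDensity fun x => ENNReal.ofReal (f x))]
    [IsProbabilityMeasure (μ.withDensity fun x => ENNReal.ofReal (g x))] :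
    (μ.withDensity fun x => ENNReal.ofReal (f x)).map L =
      μ.withDensity fun x => ENNReal.ofReal (g x) := by
  have hL : Measurable L := L.toLinearMap.continuous_of_finiteDimensional.measurable
  obtain ⟨c, hc⟩ : ∃ c : ENNReal, μ.map L = c • μ :=
    ⟨_, Measure.map_linearMap_addHaar_eq_smul_addHaar μ L.isUnit_det'.ne_zero⟩
  have hmap : (μ.withDensity fun x => ENNReal.ofReal (f x)).map L =
      (ENNReal.ofReal K * c) • μ.withDensity fun x => ENNReal.ofReal (g x) := by
    ext s hs
    rw [Measure.map_apply hL hs, withDensity_apply _ (hL hs), Measure.smul_apply,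
      withDensity_apply _ hs]
    simp_rw [h, ENNReal.ofReal_mul hK]
    rw [lintegral_const_mul' _ _ ENNReal.ofReal_ne_top,
      ← setLIntegral_map hs hg.ennreal_ofReal hL, hc, Measure.restrict_smul,
      lintegral_smul_measure, smul_eq_mul, smul_eq_mul, mul_assoc]
  have hP : IsProbabilityMeasure ((μ.withDensity fun x => ENNReal.ofReal (f x)).map L) :=
    Measure.isProbabilityMeasure_map hL.aemeasurable
  have h1 := hP.measure_univ
  rw [hmap, Measure.smul_apply, measure_univ, smul_eq_mul, mul_one] at h1
  rw [hmap, h1, one_smul]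

/-- The linear map `(x₁, x₂) ↦ ((x₁ - x₂) / (1 + r), (r x₁ + x₂) / (1 + r))`. -/
def rotationEquiv (E : Type*) [AddCommGroup E] [Module ℝ E] (r : ℝ) (hr : 1 + r ≠ 0) :
    (E × E) ≃ₗ[ℝ] (E × E) where
  toFun x := ((1 + r)⁻¹ • (x.1 - x.2), (1 + r)⁻¹ • (r • x.1 + x.2))
  invFun w := (w.1 + w.2, w.2 - r • w.1)
  map_add' x y := by
    ext <;> simp only [Prod.fst_add, Prod.snd_add] <;> module
  map_smul' c x := by
    ext <;> simp only [Prod.smul_fst, Prod.smul_snd, RingHom.id_apply] <;> module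
  left_inv x := by
    ext
    · simp only
      match_scalars <;> field_simp
      ring
    · simp only
      match_scalars <;> field_simp <;> ring
  right_inv w := by
    ext <;> simp only <;> match_scalars <;> field_simp <;> ring

lemma prod_gaussianDens (p : ℕ) {v₁ v₂ : ℝ} (hv₁ : 0 < v₁) (m₁ m₂ : Ep p) :
    (gaussianDens p v₁ m₁).prod (gaussianDens p v₂ m₂) =
      (volume : Measure (Ep p × Ep p)).withDensity
        fun x => ENNReal.ofReal (gdens p v₁ (x.1 - m₁) * gdens p v₂ (x.2 - m₂)) := by
  rw [prod_withDensity (measurable_gdens_sub p v₁ m₁).ennreal_ofReal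
    (measurable_gdens_sub p v₂ m₂).ennreal_ofReal, Measure.volume_eq_prod]
  congr with x
  rw [ENNReal.ofReal_mul (gdens_nonneg p hv₁ _)]

/-- Bias-variance decomposition for independent summands, one of them Gaussian. -/
lemma integral_norm_add_sq_prod_gaussianDens {α : Type*} [MeasurableSpace α] (p : ℕ)
    (P : Measure α) [IsProbabilityMeasure P]
    {v : ℝ} (hv : 0 < v) (m : Ep p) {b : α → Ep p} (hb : MemLp b 2 P) :
    ∫ z : α × Ep p, ‖(z.2 - m) + b z.1‖ ^ 2 ∂(P.prod (gaussianDens p v m)) =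
      ∫ x, ‖b x‖ ^ 2 ∂P + p * v := by
  have := isProbabilityMeasure_gaussianDens p hv m
  have hL := memLp_sub_gaussianDens p hv m
  have hL1 := hL.integrable one_le_two
  have hb1 := hb.integrable one_le_two
  have hcross : Integrable (fun z : α × Ep p => inner ℝ (z.2 - m) (b z.1))
      (P.prod (gaussianDens p v m)) := by
    refine (hb1.norm.mul_prod hL1.norm).mono ?_ (.of_forall fun z => ?_)
    · exact (hL1.1.comp_snd).inner (hb1.1.comp_fst)
    · rw [norm_mul, norm_norm, norm_norm, mul_comm]
      exact norm_inner_le_norm _ _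
  have h0 : ∫ z : α × Ep p, inner ℝ (z.2 - m) (b z.1) ∂(P.prod (gaussianDens p v m)) = 0 := by
    rw [integral_prod _ hcross]
    refine integral_eq_zero_of_ae (.of_forall fun x => ?_)
    simp only [Pi.zero_apply]
    simp_rw [real_inner_comm (b x)]
    rw [integral_inner hL1, integral_sub ((hL1.add (integrable_const m)).congr (.of_forall fun w => sub_add_cancel w m))
      (integrable_const m), integral_id_gaussianDens p hv]
    simp
  simp_rw [norm_add_sq_real]
  have ha2 : Integrable (fun z : α × Ep p => ‖z.2 - m‖ ^ 2) (P.prod (gaussianDens p v m)) :=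
    hL.norm.integrable_sq.comp_snd P
  have hb2 : Integrable (fun z : α × Ep p => ‖b z.1‖ ^ 2) (P.prod (gaussianDens p v m)) :=
    hb.norm.integrable_sq.comp_fst _
  rw [integral_add (f := fun z : α × Ep p => ‖z.2 - m‖ ^ 2 + 2 * inner ℝ (z.2 - m) (b z.1))
    (ha2.add (hcross.const_mul 2)) hb2, integral_add ha2 (hcross.const_mul 2),
    integral_const_mul, h0, integral_fun_snd (fun w => ‖w - m‖ ^ 2),
    integral_fun_fst (fun x => ‖b x‖ ^ 2), integral_norm_sub_sq_gaussianDens p hv]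
  simp [add_comm]

/-- (a) `W1 = (X1 - X2)/(1+r)` and `W2 = (r X1 + X2)/(1+r)` are independent Gaussians
with means `μ1, μ2` and covariances `(σ1²/(1+r)) I`, `(σ2²/(1+r)) I`;
(b) the squared-error risk of `δ_ψ(X) = W2 + ψ(W1)` decomposes as
`E‖ψ(W1) - μ1‖² + p σ2²/(1+r)`;
(c) hence risk comparisons for such estimators reduce to the `W1`-model. -/
theorem stmt3 (p : ℕ) (σ12 σ22 : ℝ) (hσ1 : 0 < σ12) (hσ2 : 0 < σ22)
    (θ1 θ2 : Ep p) (r : ℝ) (hr : r = σ22 / σ12)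
    (μ1 μ2 : Ep p) (hμ1 : μ1 = (1 + r)⁻¹ • (θ1 - θ2))
    (hμ2 : μ2 = (1 + r)⁻¹ • (r • θ1 + θ2)) :
    (Measure.map
        (fun x : Ep p × Ep p =>
          ((1 + r)⁻¹ • (x.1 - x.2), (1 + r)⁻¹ • (r • x.1 + x.2)))
        ((volume : Measure (Ep p × Ep p)).withDensity
          (fun x => ENNReal.ofReal (jointDens p σ12 σ22 θ1 θ2 x))) =
      ((volume : Measure (Ep p)).withDensity
          (fun w => ENNReal.ofReal (gdens p (σ12 / (1 + r)) (w - μ1)))).prod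
        ((volume : Measure (Ep p)).withDensity
          (fun w => ENNReal.ofReal (gdens p (σ22 / (1 + r)) (w - μ2))))) ∧
    (∀ ψ : Ep p → Ep p, Measurable ψ →
      Integrable (fun w : Ep p => ‖ψ w - μ1‖ ^ 2 * gdens p (σ12 / (1 + r)) (w - μ1)) →
      (∫ x : Ep p × Ep p,
          ‖(1 + r)⁻¹ • (r • x.1 + x.2) + ψ ((1 + r)⁻¹ • (x.1 - x.2)) - θ1‖ ^ 2 *
            jointDens p σ12 σ22 θ1 θ2 x) =
        (∫ w : Ep p, ‖ψ w - μ1‖ ^ 2 * gdens p (σ12 / (1 + r)) (w - μ1)) +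
          (p : ℝ) * σ22 / (1 + r)) ∧
    (∀ ψA ψB : Ep p → Ep p, Measurable ψA → Measurable ψB →
      Integrable (fun w : Ep p => ‖ψA w - μ1‖ ^ 2 * gdens p (σ12 / (1 + r)) (w - μ1)) →
      Integrable (fun w : Ep p => ‖ψB w - μ1‖ ^ 2 * gdens p (σ12 / (1 + r)) (w - μ1)) →
      ((∫ x : Ep p × Ep p,
          ‖(1 + r)⁻¹ • (r • x.1 + x.2) + ψA ((1 + r)⁻¹ • (x.1 - x.2)) - θ1‖ ^ 2 *
            jointDens p σ12 σ22 θ1 θ2 x) ≤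
        (∫ x : Ep p × Ep p,
          ‖(1 + r)⁻¹ • (r • x.1 + x.2) + ψB ((1 + r)⁻¹ • (x.1 - x.2)) - θ1‖ ^ 2 *
            jointDens p σ12 σ22 θ1 θ2 x) ↔
        (∫ w : Ep p, ‖ψA w - μ1‖ ^ 2 * gdens p (σ12 / (1 + r)) (w - μ1)) ≤
          (∫ w : Ep p, ‖ψB w - μ1‖ ^ 2 * gdens p (σ12 / (1 + r)) (w - μ1)))) := by
  have hrpos : 0 < r := hr ▸ div_pos hσ2 hσ1
  have h1r : 0 < 1 + r := by linarith
  have hσ : σ22 = r * σ12 := by rw [hr]; field_simp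
  have hv1 : 0 < σ12 / (1 + r) := by positivity
  have hv2 : 0 < σ22 / (1 + r) := by positivity
  set L := rotationEquiv (Ep p) r h1r.ne'
  have hLm : Measurable L := L.toLinearMap.continuous_of_finiteDimensional.measurable
  have hθ : μ1 + μ2 = θ1 := by
    rw [hμ1, hμ2]
    match_scalars <;> field_simp
    ring
  have hJ0 : ∀ x, 0 ≤ jointDens p σ12 σ22 θ1 θ2 x := fun x =>
    mul_nonneg (gdens_nonneg p hσ1 _) (gdens_nonneg p hσ2 _)
  have hJm : Measurable (jointDens p σ12 σ22 θ1 θ2) :=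
    ((measurable_gdens_sub p σ12 θ1).comp measurable_fst).mul
      ((measurable_gdens_sub p σ22 θ2).comp measurable_snd)
  have hPW1 := isProbabilityMeasure_gaussianDens p hv1 μ1
  have hPW2 := isProbabilityMeasure_gaussianDens p hv2 μ2
  have hlaw : ((volume : Measure (Ep p × Ep p)).withDensity
      fun x => ENNReal.ofReal (jointDens p σ12 σ22 θ1 θ2 x)).map L =
      (gaussianDens p (σ12 / (1 + r)) μ1).prod (gaussianDens p (σ22 / (1 + r)) μ2) := by
    have hPX1 := isProbabilityMeasure_gaussianDens p hσ1 θ1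
    have hPX2 := isProbabilityMeasure_gaussianDens p hσ2 θ2
    have hPX : IsProbabilityMeasure ((volume : Measure (Ep p × Ep p)).withDensity
        fun x => ENNReal.ofReal (jointDens p σ12 σ22 θ1 θ2 x)) := by
      unfold jointDens
      rw [← prod_gaussianDens p hσ1]
      infer_instance
    have hPW : IsProbabilityMeasure ((volume : Measure (Ep p × Ep p)).withDensity
        fun x => ENNReal.ofReal
          (gdens p (σ12 / (1 + r)) (x.1 - μ1) * gdens p (σ22 / (1 + r)) (x.2 - μ2))) := by
      rw [← prod_gaussianDens p hv1]
      infer_instance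
    have : (volume : Measure (Ep p × Ep p)).IsAddHaarMeasure := by
      rw [Measure.volume_eq_prod]
      infer_instance
    rw [prod_gaussianDens p hv1]
    have hC : 0 < (2 * Real.pi * (σ12 / (1 + r))) ^ (-(p : ℝ) / 2) *
      (2 * Real.pi * (σ22 / (1 + r))) ^ (-(p : ℝ) / 2) := by positivity
    refine map_withDensity_of_eq_const_mul volume L
      (g := fun x => gdens p (σ12 / (1 + r)) (x.1 - μ1) * gdens p (σ22 / (1 + r)) (x.2 - μ2))
      (K := (2 * Real.pi * σ12) ^ (-(p : ℝ) / 2) * (2 * Real.pi * σ22) ^ (-(p : ℝ) / 2) /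
        ((2 * Real.pi * (σ12 / (1 + r))) ^ (-(p : ℝ) / 2) *
          (2 * Real.pi * (σ22 / (1 + r))) ^ (-(p : ℝ) / 2))) (by positivity)
      (((measurable_gdens_sub p _ μ1).comp measurable_fst).mul
        ((measurable_gdens_sub p _ μ2).comp measurable_snd)) fun x => ?_
    have e1 : (L x).1 - μ1 = (1 + r)⁻¹ • ((x.1 - θ1) - (x.2 - θ2)) := by
      rw [hμ1]
      change (1 + r)⁻¹ • (x.1 - x.2) - _ = _
      module
    have e2 : (L x).2 - μ2 = (1 + r)⁻¹ • (r • (x.1 - θ1) + (x.2 - θ2)) := by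
      rw [hμ2]
      change (1 + r)⁻¹ • (r • x.1 + x.2) - _ = _
      module
    rw [e1, e2]
    unfold jointDens gdens
    generalize x.1 - θ1 = a
    generalize x.2 - θ2 = b
    rw [mul_mul_mul_comm, ← Real.exp_add, mul_mul_mul_comm, ← Real.exp_add, ← mul_assoc,
      div_mul_cancel₀ _ hC.ne']
    congr 2
    rw [norm_smul, norm_smul, mul_pow, mul_pow, norm_sub_sq_real, norm_add_sq_real, norm_smul,
      real_inner_smul_left, Real.norm_of_nonneg hrpos.le, Real.norm_of_nonneg (by positivity), hσ]
    field_simp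
    ring
  have hrisk : ∀ ψ : Ep p → Ep p, Measurable ψ →
      Integrable (fun w : Ep p => ‖ψ w - μ1‖ ^ 2 * gdens p (σ12 / (1 + r)) (w - μ1)) →
      (∫ x : Ep p × Ep p,
          ‖(1 + r)⁻¹ • (r • x.1 + x.2) + ψ ((1 + r)⁻¹ • (x.1 - x.2)) - θ1‖ ^ 2 *
            jointDens p σ12 σ22 θ1 θ2 x) =
        (∫ w : Ep p, ‖ψ w - μ1‖ ^ 2 * gdens p (σ12 / (1 + r)) (w - μ1)) +
          (p : ℝ) * σ22 / (1 + r) := by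
    intro ψ hψ hint
    have hLp : MemLp (fun w => ψ w - μ1) 2 (gaussianDens p (σ12 / (1 + r)) μ1) := by
      rw [memLp_two_iff_integrable_sq_norm (hψ.sub_const μ1).aestronglyMeasurable,
        integrable_withDensity_iff (measurable_gdens_sub p _ μ1).ennreal_ofReal (by simp)]
      simpa only [ENNReal.toReal_ofReal (gdens_nonneg p hv1 _)] using hint
    have key := integral_norm_add_sq_prod_gaussianDens p _ hv2 μ2 hLp
    rw [← hlaw, integral_map hLm.aemeasurable (by fun_prop), integral_withDensity_ofReal hJm hJ0,
      integral_withDensity_ofReal (measurable_gdens_sub p _ μ1)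
        (fun w => gdens_nonneg p hv1 _)] at key
    simp only [smul_eq_mul] at key
    simp_rw [mul_comm _ (jointDens p σ12 σ22 θ1 θ2 _), mul_comm _ (gdens p _ (_ - μ1))]
    rw [mul_div_assoc, ← key]
    congr with x
    congr 3
    rw [← hθ]
    change _ = (1 + r)⁻¹ • (r • x.1 + x.2) - μ2 + (ψ ((1 + r)⁻¹ • (x.1 - x.2)) - μ1)
    abel
  refine ⟨hlaw, hrisk, fun ψA ψB hA hB hiA hiB => ?_⟩
  rw [hrisk ψA hA hiA, hrisk ψB hB hiB, add_le_add_iff_right]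


end
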